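/- Let α ∈ (0,1) be irrational, ρ ∈ [0,1), let s = s_{α,ρ} be the Sturmian word of slope α and intercept ρ, and let c = s_{α,α} be the characteristic Sturmian word of slope α. For every ℓ ≥ 1 there exists a map B : {0,1}^{2ℓ} → 𝒫({0,1}^ℓ × {0,1}^ℓ) such that for every n > ℓ, ∂_{s,ℓ}[n] = B(c[n−ℓ−1] c[n−ℓ] ⋯ c[n+ℓ−2]). In other words, the shifted ℓ-boundary sequence (∂_{s,ℓ}[n])_{n≥ℓ+1} is obtained by a sliding block code of length 2ℓ applied to the characteristic Sturmian word of slope α. -/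

import Mathlib

/-- The Sturmian word of slope `α` and intercept `ρ`:
`s[n] = 0` iff `{ρ + nα} ∈ [0, 1−α)`. -/
noncomputable def sturmian (α ρ : ℝ) (n : ℕ) : Fin 2 :=
  if Int.fract (ρ + n * α) < 1 - α then 0 else 1

/-- The `n`-th boundary set of the infinite word `x` with window length `ℓ`. -/
def boundarySet {A : Type*} (x : ℕ → A) (ℓ n : ℕ) :
    Set ((Fin ℓ → A) × (Fin ℓ → A)) :=
  {p | ∃ i : ℕ, (∀ k : Fin ℓ, p.1 k = x (i + k)) ∧ (∀ k : Fin ℓ, p.2 k = x (i + n + k))}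

open Int in
/-- The letters of a Sturmian word are the increments of `n ↦ ⌊ρ + nα⌋`. -/
theorem sturmian_val_eq_floor_sub_floor {α : ℝ} (hα0 : 0 < α) (hα1 : α < 1) (ρ : ℝ) (n : ℕ) :
    ((sturmian α ρ n).val : ℤ) = ⌊ρ + n * α + α⌋ - ⌊ρ + n * α⌋ := by
  have h := floor_add_fract (ρ + n * α)
  have h0 := fract_nonneg (ρ + n * α)
  have h1 := fract_lt_one (ρ + n * α)
  unfold sturmian
  split_ifs with hlt
  · have : ⌊ρ + n * α + α⌋ = ⌊ρ + n * α⌋ := by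
      rw [floor_eq_iff]; constructor <;> linarith
    simp [this]
  · have : ⌊ρ + n * α + α⌋ = ⌊ρ + n * α⌋ + 1 := by
      rw [floor_eq_iff]; push_cast; constructor <;> linarith
    simp [this]

/-- Floors along a progression of step `α` differ by a constant
exactly when the corresponding blocks of Sturmian words coincide. -/
theorem forall_sturmian_eq_iff {α : ℝ} (hα0 : 0 < α) (hα1 : α < 1) (ρ σ : ℝ) (i j L : ℕ) :
    (∀ k < L, sturmian α ρ (i + k) = sturmian α σ (j + k)) ↔
      ∀ k ≤ L, ⌊ρ + i * α + k * α⌋ - ⌊ρ + i * α⌋ = ⌊σ + j * α + k * α⌋ - ⌊σ + j * α⌋ := by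
  have key (τ : ℝ) (m k : ℕ) : ((sturmian α τ (m + k)).val : ℤ) =
      ⌊τ + m * α + (k + 1 : ℕ) * α⌋ - ⌊τ + m * α + k * α⌋ := by
    rw [sturmian_val_eq_floor_sub_floor hα0 hα1]
    push_cast
    ring_nf
  constructor
  · intro h k
    induction k with
    | zero => simp
    | succ k ih =>
      intro hk
      have h1 := ih (by omega)
      have h2 := h k (by omega)
      have h3 := key ρ i k
      have h4 := key σ j k
      rw [h2] at h3
      omega
  · intro h k hk
    have h1 := h k hk.le
    have h2 := h (k + 1) hk
    have h3 := key ρ i k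
    have h4 := key σ j k
    apply Fin.ext
    omega

/-- The forward orbit of any point under an irrational rotation is dense modulo `1`. -/
theorem exists_nat_int_add_mul_mem_Ioo {α : ℝ} (hirr : Irrational α) (ρ : ℝ) {a b : ℝ}
    (hab : a < b) : ∃ (i : ℕ) (N : ℤ), ρ + i * α + N ∈ Set.Ioo a b := by
  have hd : DenseRange (fun n : ℕ => n • ((α : ℝ) : AddCircle (1 : ℝ))) :=
    denseRange_zsmul_iff_nsmul.1 (AddCircle.denseRange_zsmul_coe_iff.2 (by simpa using hirr))
  have hopen : IsOpen ((↑) '' Set.Ioo (a - ρ) (b - ρ) : Set (AddCircle (1 : ℝ))) :=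
    QuotientAddGroup.isOpenMap_coe _ isOpen_Ioo
  obtain ⟨i, t, ht, hti⟩ := hd.exists_mem_open hopen
    (Set.Nonempty.image _ (Set.nonempty_Ioo.2 (by linarith)))
  have hti' : ((t - i * α : ℝ) : AddCircle (1 : ℝ)) = 0 := by
    rw [AddCircle.coe_sub, hti, ← nsmul_eq_mul, AddCircle.coe_nsmul, sub_self]
  obtain ⟨N, hN⟩ := (AddCircle.coe_eq_zero_iff (1 : ℝ)).1 hti'
  refine ⟨i, N, ?_⟩
  simp only [zsmul_eq_mul, mul_one] at hN
  rw [hN]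
  constructor <;> linarith [ht.1, ht.2]

/-- Finitely many floors are simultaneously constant on a right neighbourhood. -/
theorem exists_pos_forall_floor_eq {ι : Type*} (s : Finset ι) (f : ι → ℝ) :
    ∃ η > 0, ∀ t, 0 ≤ t → t < η → ∀ i ∈ s, ⌊f i + t⌋ = ⌊f i⌋ := by
  classical
  induction s using Finset.induction_on with
  | empty => exact ⟨1, one_pos, by simp⟩
  | insert a s _ ih =>
    obtain ⟨η, hη, h⟩ := ih
    refine ⟨min η (⌊f a⌋ + 1 - f a), lt_min hη (by linarith [Int.lt_floor_add_one (f a)]), ?_⟩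
    intro t ht0 ht i hi
    rcases Finset.mem_insert.1 hi with rfl | hi
    · rw [Int.floor_eq_iff]
      have := ht.trans_le (min_le_right _ _)
      constructor <;> linarith [Int.floor_le (f i)]
    · exact h t ht0 (ht.trans_le (min_le_left _ _)) i hi

/-- If no point `-mα` with `|m| ≤ ℓ` separates `y ≤ z` modulo `1`, then every pair of positions
at distance `y` can be moved to one at distance `z` without changing floors. -/
theorem exists_forall_floor_eq_of_le {α y z : ℝ} {ℓ : ℕ} (hyz : y ≤ z)
    (h : ∀ m : ℤ, |m| ≤ ℓ → ⌊y + m * α⌋ = ⌊z + m * α⌋) (x : ℝ) :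
    ∃ x', ∀ k : ℕ, k ≤ ℓ →
      ⌊x' + k * α⌋ = ⌊x + k * α⌋ ∧ ⌊x' + z + k * α⌋ = ⌊x + y + k * α⌋ := by
  obtain ⟨j, hj, hmin⟩ := Finset.exists_min_image (Finset.range (ℓ + 1))
    (fun k : ℕ => Int.fract (x + k * α)) ⟨0, by simp⟩
  simp only [Finset.mem_range, Nat.lt_succ_iff] at hj hmin
  have hfloor {ε : ℝ} (h0 : 0 ≤ ε) (hε : ε ≤ Int.fract (x + j * α)) {k : ℕ} (hk : k ≤ ℓ) :
      ⌊x - ε + k * α⌋ = ⌊x + k * α⌋ := by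
    have h1 := hmin k hk
    have h2 := Int.floor_add_fract (x + k * α)
    have h3 := Int.fract_lt_one (x + k * α)
    rw [Int.floor_eq_iff]
    constructor <;> linarith
  rcases le_total (z - y) (Int.fract (x + j * α)) with hle | hle
  · refine ⟨x - (z - y), fun k hk => ⟨hfloor (by linarith) hle hk, ?_⟩⟩
    congr 1
    ring
  · refine ⟨x - Int.fract (x + j * α), fun k hk =>
      ⟨hfloor (Int.fract_nonneg _) le_rfl hk, le_antisymm ?_ ?_⟩⟩
    · have hm := h ((k : ℤ) - j) (by rw [abs_le]; omega)
      push_cast at hm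
      have hx : x - Int.fract (x + j * α) = (⌊x + j * α⌋ : ℝ) - j * α := by
        linarith [Int.floor_add_fract (x + j * α)]
      have hz : x - Int.fract (x + j * α) + z + k * α =
          z + (k - j) * α + (⌊x + j * α⌋ : ℝ) := by rw [hx]; ring
      have hy : x - Int.fract (x + j * α) + y + k * α =
          y + (k - j) * α + (⌊x + j * α⌋ : ℝ) := by rw [hx]; ring
      rw [hz, Int.floor_add_intCast, ← hm, ← Int.floor_add_intCast, ← hy]
      exact Int.floor_le_floor (by linarith [Int.fract_nonneg (x + j * α)])
    · exact Int.floor_le_floor (by linarith)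

theorem floor_neg_eq_of_floor_eq {a b : ℝ} (hab : ⌊a⌋ = ⌊b⌋) (ha : ∀ N : ℤ, a ≠ N)
    (hb : ∀ N : ℤ, b ≠ N) : ⌊-a⌋ = ⌊-b⌋ := by
  have key {t : ℝ} (ht : ∀ N : ℤ, t ≠ N) : ⌊-t⌋ = -⌊t⌋ - 1 := by
    have h1 := lt_of_le_of_ne (Int.floor_le t) (ht _).symm
    have h2 := Int.lt_floor_add_one t
    rw [Int.floor_eq_iff]
    push_cast
    constructor <;> linarith
  rw [key ha, key hb, hab]

/-- Version of `exists_forall_floor_eq_of_le` for `y` and `z` in either order. -/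
theorem exists_forall_floor_eq {α y z : ℝ} {ℓ : ℕ}
    (h : ∀ m : ℤ, |m| ≤ ℓ → ⌊y + m * α⌋ = ⌊z + m * α⌋)
    (hy : ∀ m N : ℤ, |m| ≤ ℓ → y + m * α ≠ N) (hz : ∀ m N : ℤ, |m| ≤ ℓ → z + m * α ≠ N) (x : ℝ) :
    ∃ x', ∀ k : ℕ, k ≤ ℓ →
      ⌊x' + k * α⌋ = ⌊x + k * α⌋ ∧ ⌊x' + z + k * α⌋ = ⌊x + y + k * α⌋ := by
  rcases le_total y z with hyz | hyz
  · exact exists_forall_floor_eq_of_le hyz h x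
  · have hneg (m : ℤ) (hm : |m| ≤ ℓ) : ⌊-y + m * α⌋ = ⌊-z + m * α⌋ := by
      have hm' : |-m| ≤ ℓ := by rwa [abs_neg]
      have := floor_neg_eq_of_floor_eq (h _ hm') (fun N => hy _ N hm') (fun N => hz _ N hm')
      push_cast at this
      convert this using 2 <;> ring
    obtain ⟨x₀, hx₀⟩ := exists_forall_floor_eq_of_le (neg_le_neg hyz) hneg (x + y)
    refine ⟨x₀ - z, fun k hk => ?_⟩
    obtain ⟨h1, h2⟩ := hx₀ k hk
    rw [add_neg_cancel_right] at h2
    rw [sub_add_cancel]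
    exact ⟨by rw [← h2, sub_eq_add_neg], h1⟩

theorem Irrational.natCast_mul_add_intCast_mul_ne_intCast {α : ℝ} (hirr : Irrational α) {n ℓ : ℕ}
    (hn : ℓ < n) {m : ℤ} (hm : |m| ≤ ℓ) (N : ℤ) : n * α + m * α ≠ N := by
  intro h
  rw [abs_le] at hm
  have hne : (n : ℤ) + m ≠ 0 := by omega
  apply (hirr.intCast_mul hne).ne_int N
  push_cast
  linarith

/-- For `n > ℓ`, the boundary set of a Sturmian word at `n` depends only on the block of length
`2ℓ` of the characteristic word starting at `n - ℓ - 1`. -/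
theorem boundarySet_sturmian_subset {α : ℝ} (hα0 : 0 < α) (hα1 : α < 1) (hirr : Irrational α)
    (ρ : ℝ) {ℓ n n' : ℕ} (hn : ℓ < n) (hn' : ℓ < n')
    (h : ∀ k < 2 * ℓ, sturmian α α (n - ℓ - 1 + k) = sturmian α α (n' - ℓ - 1 + k)) :
    boundarySet (sturmian α ρ) ℓ n ⊆ boundarySet (sturmian α ρ) ℓ n' := by
  rw [forall_sturmian_eq_iff hα0 hα1] at h
  have hcast {p : ℕ} (hp : ℓ < p) : α + (p - ℓ - 1 : ℕ) * α = p * α - ℓ * α := by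
    rw [Nat.sub_sub, Nat.cast_sub hp]
    push_cast
    ring
  rw [hcast hn, hcast hn'] at h
  set C : ℤ := ⌊n * α - ℓ * α⌋ - ⌊n' * α - ℓ * α⌋ with hC
  have hfloor (m : ℤ) (hm : |m| ≤ ℓ) : ⌊n * α + m * α⌋ = ⌊n' * α + C + m * α⌋ := by
    rw [abs_le] at hm
    obtain ⟨k, hk⟩ := Int.eq_ofNat_of_zero_le (show 0 ≤ m + ℓ by omega)
    have hk' : (m : ℝ) = k - ℓ := by
      rw [eq_sub_iff_add_eq]; exact_mod_cast hk
    have h1 := h k (by omega)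
    have h2 : n' * α + C + m * α = n' * α - ℓ * α + k * α + C := by rw [hk']; ring
    have h3 : n * α + m * α = n * α - ℓ * α + k * α := by rw [hk']; ring
    rw [h2, h3, Int.floor_add_intCast]
    omega
  rintro ⟨u, v⟩ ⟨i, hu, hv⟩
  obtain ⟨x, hx⟩ := exists_forall_floor_eq hfloor
    (fun m N hm => hirr.natCast_mul_add_intCast_mul_ne_intCast hn hm N)
    (fun m N hm hN => hirr.natCast_mul_add_intCast_mul_ne_intCast hn' hm (N - C)
      (by push_cast; linarith)) (ρ + i * α)
  obtain ⟨η₁, hη₁, hconst₁⟩ := exists_pos_forall_floor_eq (Finset.range (ℓ + 1))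
    (fun k : ℕ => x + k * α)
  obtain ⟨η₂, hη₂, hconst₂⟩ := exists_pos_forall_floor_eq (Finset.range (ℓ + 1))
    (fun k : ℕ => x + (n' * α + C) + k * α)
  obtain ⟨i', N, hlo, hhi⟩ := exists_nat_int_add_mul_mem_Ioo hirr ρ
    (lt_add_of_pos_right x (lt_min hη₁ hη₂))
  have hlt := sub_lt_iff_lt_add'.2 hhi
  have hfst (k : ℕ) (hk : k ≤ ℓ) : ⌊ρ + i' * α + k * α⌋ = ⌊ρ + i * α + k * α⌋ - N := by
    have h1 := hconst₁ _ (sub_nonneg.2 hlo.le) (hlt.trans_le (min_le_left _ _)) k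
      (Finset.mem_range_succ_iff.2 hk)
    have h2 : x + k * α + (ρ + i' * α + N - x) = ρ + i' * α + k * α + N := by ring
    rw [h2, Int.floor_add_intCast, (hx k hk).1] at h1
    exact eq_sub_of_add_eq h1
  have hsnd (k : ℕ) (hk : k ≤ ℓ) :
      ⌊ρ + (i' + n' : ℕ) * α + k * α⌋ = ⌊ρ + (i + n : ℕ) * α + k * α⌋ - (N + C) := by
    have h1 := hconst₂ _ (sub_nonneg.2 hlo.le) (hlt.trans_le (min_le_right _ _)) k
      (Finset.mem_range_succ_iff.2 hk)
    have h2 : x + (n' * α + C) + k * α + (ρ + i' * α + N - x) =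
        ρ + (i' + n' : ℕ) * α + k * α + (N + C : ℤ) := by push_cast; ring
    have h3 : ρ + (i + n : ℕ) * α + k * α = ρ + i * α + n * α + k * α := by push_cast; ring
    rw [h2, Int.floor_add_intCast, (hx k hk).2, ← h3] at h1
    exact eq_sub_of_add_eq h1
  have hu' := (forall_sturmian_eq_iff hα0 hα1 ρ ρ i i' ℓ).2 fun k hk => by
    have h0 := hfst 0 (Nat.zero_le _)
    simp only [Nat.cast_zero, zero_mul, add_zero] at h0
    have := hfst k hk
    omega
  have hv' := (forall_sturmian_eq_iff hα0 hα1 ρ ρ (i + n) (i' + n') ℓ).2 fun k hk => by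
    have h0 := hsnd 0 (Nat.zero_le _)
    simp only [Nat.cast_zero, zero_mul, add_zero] at h0
    have := hsnd k hk
    omega
  exact ⟨i', fun k => (hu k).trans (hu' k k.2), fun k => (hv k).trans (hv' k k.2)⟩

/-- for a Sturmian word `s` of irrational slope `α ∈ (0,1)` and intercept
`ρ` and every `ℓ ≥ 1`, there is a map `B` from length-`2ℓ` binary words to boundary
sets such that for every `n > ℓ`,
`∂_{s,ℓ}[n] = B(c[n−ℓ−1] ⋯ c[n+ℓ−2])`, where `c` is the characteristic Sturmian word
of slope `α`: the shifted `ℓ`-boundary sequence is a sliding block code (of length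
`2ℓ`) of `c`. -/
theorem stmt12 (α : ℝ) (hα0 : 0 < α) (hα1 : α < 1) (hirr : Irrational α)
    (ρ : ℝ) (hρ0 : 0 ≤ ρ) (hρ1 : ρ < 1) (ℓ : ℕ) (hℓ : 1 ≤ ℓ) :
    ∃ B : (Fin (2 * ℓ) → Fin 2) → Set ((Fin ℓ → Fin 2) × (Fin ℓ → Fin 2)),
      ∀ n : ℕ, ℓ < n →
        boundarySet (sturmian α ρ) ℓ n =
          B (fun k : Fin (2 * ℓ) => sturmian α α (n - ℓ - 1 + k)) := by
  refine ⟨fun w => {p | ∃ n, ℓ < n ∧ (fun k : Fin (2 * ℓ) => sturmian α α (n - ℓ - 1 + k)) = w ∧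
    p ∈ boundarySet (sturmian α ρ) ℓ n}, fun n hn => Set.Subset.antisymm ?_ ?_⟩
  · exact fun p hp => ⟨n, hn, rfl, hp⟩
  · rintro p ⟨n', hn', hw, hp⟩
    exact boundarySet_sturmian_subset hα0 hα1 hirr ρ hn' hn
      (fun k hk => congrFun hw ⟨k, hk⟩) hp
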